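/- arXiv:1503.04353 — 2 statements merged into one kernel-verified Lean document; each statement's English description precedes it below -/
import Mathlib

section
/- The probability measure N supported on [0,e] whose Stieltjes transform f satisfies (1 + f(z))·Log(1 + f(z)) = −1/z on ℂ∖[0,∞) is absolutely continuous with a density ρ that is continuous on (0,e) and has the following edge asymptotics: lim_{λ→0⁺} ρ(λ)·λ·(ln λ)² = 1, and there exists a constant C > 0 such that lim_{λ→e⁻} ρ(λ)/(e − λ)^{1/2} = C. -/
open MeasureTheory Complex Filter

/-- The Stieltjes transform of a measure on `ℝ`. -/
noncomputable def stieltjesTransform (N : Measure ℝ) (z : ℂ) : ℂ :=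
  ∫ l : ℝ, ((l : ℂ) - z)⁻¹ ∂N

/-- The cut plane `ℂ ∖ [0,∞)`. -/
def cutPlane : Set ℂ := {z : ℂ | z.im ≠ 0 ∨ z.re < 0}

open Set Topology

/-! ### The angular parametrization of the support -/

/-- The logarithm of the point of `(0, e)` at which the boundary value of `1 + f` has
argument `θ`. -/
noncomputable def logEdgePoint (θ : ℝ) : ℝ :=
  Real.log (Real.sin θ) - Real.log θ + θ * Real.cos θ / Real.sin θ

/-- The point of `(0, e)` at which the boundary value of `1 + f` has argument `θ`. -/
noncomputable def edgePoint (θ : ℝ) : ℝ := Real.exp (logEdgePoint θ)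

lemma hasDerivAt_logEdgePoint {θ : ℝ} (hθ : θ ∈ Ioo 0 Real.pi) :
    HasDerivAt logEdgePoint
      (-(((θ - Real.sin θ * Real.cos θ) / (θ * Real.sin θ)) ^ 2 * θ
        + Real.sin θ ^ 2 / θ)) θ := by
  have hs : Real.sin θ ≠ 0 := (Real.sin_pos_of_mem_Ioo hθ).ne'
  have h0 : θ ≠ 0 := hθ.1.ne'
  have h := (((Real.hasDerivAt_sin θ).log hs).sub (Real.hasDerivAt_log h0)).add
    (((hasDerivAt_id θ).mul (Real.hasDerivAt_cos θ)).div (Real.hasDerivAt_sin θ) hs)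
  refine h.congr_deriv ?_
  have hsc := Real.sin_sq_add_cos_sq θ
  simp only [id, Pi.mul_apply]
  field_simp
  linear_combination (Real.sin θ ^ 2 - θ ^ 2) * hsc

lemma strictAntiOn_logEdgePoint : StrictAntiOn logEdgePoint (Ioo 0 Real.pi) := by
  refine strictAntiOn_of_deriv_neg (convex_Ioo _ _)
    (fun θ hθ => (hasDerivAt_logEdgePoint hθ).continuousAt.continuousWithinAt) ?_
  intro θ hθ
  rw [interior_Ioo] at hθ
  rw [(hasDerivAt_logEdgePoint hθ).deriv]
  have hs := Real.sin_pos_of_mem_Ioo hθ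
  have h0 : 0 < θ := hθ.1
  have : 0 < Real.sin θ ^ 2 / θ := by positivity
  have : 0 ≤ ((θ - Real.sin θ * Real.cos θ) / (θ * Real.sin θ)) ^ 2 * θ := by positivity
  linarith

lemma strictAntiOn_edgePoint : StrictAntiOn edgePoint (Ioo 0 Real.pi) :=
  fun _ ha _ hb hab => Real.exp_lt_exp.2 (strictAntiOn_logEdgePoint ha hb hab)

lemma tendsto_sin_div_nhdsGT_zero :
    Tendsto (fun θ : ℝ => Real.sin θ / θ) (𝓝[>] 0) (𝓝 1) := by
  have h := (Real.hasDerivAt_sin 0).tendsto_slope_zero_right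
  simpa [div_eq_inv_mul] using h

lemma tendsto_logEdgePoint_zero : Tendsto logEdgePoint (𝓝[>] 0) (𝓝 1) := by
  have h1 : Tendsto (fun θ : ℝ => Real.log (Real.sin θ / θ)
      + Real.cos θ * (Real.sin θ / θ)⁻¹) (𝓝[>] 0) (𝓝 (Real.log 1 + Real.cos 0 * 1⁻¹)) :=
    (tendsto_sin_div_nhdsGT_zero.log one_ne_zero).add
      (((Real.continuous_cos.tendsto 0).mono_left nhdsWithin_le_nhds).mul
        (tendsto_sin_div_nhdsGT_zero.inv₀ one_ne_zero))
  simp only [Real.log_one, Real.cos_zero, inv_one, mul_one, zero_add] at h1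
  refine h1.congr' ?_
  filter_upwards [Ioo_mem_nhdsGT Real.pi_pos] with θ hθ
  have hs := Real.sin_pos_of_mem_Ioo hθ
  have h0 : 0 < θ := hθ.1
  rw [logEdgePoint, Real.log_div hs.ne' h0.ne']
  field_simp

lemma tendsto_sub_sin_mul_cos_div_nhdsGT_zero :
    Tendsto (fun θ : ℝ => (θ - Real.sin θ * Real.cos θ) / θ ^ 2) (𝓝[>] 0) (𝓝 0) := by
  have hg : Tendsto (fun θ : ℝ => θ) (𝓝[>] 0) (𝓝 0) :=
    tendsto_id.mono_left nhdsWithin_le_nhds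
  refine squeeze_zero' ?_ ?_ hg
  · filter_upwards [self_mem_nhdsWithin] with θ (hθ : 0 < θ)
    have h := Real.sin_le (x := 2 * θ) (by positivity)
    rw [Real.sin_two_mul] at h
    have : 0 ≤ θ - Real.sin θ * Real.cos θ := by linarith
    positivity
  · filter_upwards [self_mem_nhdsWithin] with θ (hθ : 0 < θ)
    have h := Real.sin_gt_sub_cube (x := 2 * θ) (by positivity)
    rw [Real.sin_two_mul] at h
    rw [div_le_iff₀ (by positivity)]
    have : 0 < θ ^ 3 := by positivity
    nlinarith

lemma tendsto_one_sub_logEdgePoint_div :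
    Tendsto (fun θ => (1 - logEdgePoint θ) / θ ^ 2) (𝓝[>] 0) (𝓝 (1 / 2)) := by
  have hpi : ∀ᶠ θ : ℝ in 𝓝[>] 0, θ ∈ Ioo 0 Real.pi := Ioo_mem_nhdsGT Real.pi_pos
  refine HasDerivAt.lhopital_zero_nhdsGT
    (f' := fun θ => ((θ - Real.sin θ * Real.cos θ) / (θ * Real.sin θ)) ^ 2 * θ
        + Real.sin θ ^ 2 / θ) (g' := fun θ => 2 * θ) ?_ ?_ ?_ ?_ ?_ ?_
  · filter_upwards [hpi] with θ hθ
    exact ((hasDerivAt_logEdgePoint hθ).const_sub 1).congr_deriv (by ring)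
  · exact Eventually.of_forall fun θ => by simpa using hasDerivAt_pow 2 θ
  · filter_upwards [hpi] with θ hθ
    exact mul_ne_zero two_ne_zero hθ.1.ne'
  · simpa using tendsto_logEdgePoint_zero.const_sub 1
  · have : Tendsto (fun θ : ℝ => θ ^ 2) (𝓝 0) (𝓝 (0 ^ 2)) := (continuous_pow 2).tendsto 0
    simpa using this.mono_left nhdsWithin_le_nhds
  · have h := ((((tendsto_sub_sin_mul_cos_div_nhdsGT_zero.mul
      (tendsto_sin_div_nhdsGT_zero.inv₀ one_ne_zero)).pow 2).add
      (tendsto_sin_div_nhdsGT_zero.pow 2)).div_const 2)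
    have h' : ((0 * (1 : ℝ)⁻¹) ^ 2 + 1 ^ 2) / 2 = 1 / 2 := by norm_num
    rw [h'] at h
    refine h.congr' ?_
    filter_upwards [hpi] with θ hθ
    have hs : Real.sin θ ≠ 0 := (Real.sin_pos_of_mem_Ioo hθ).ne'
    have h0 : θ ≠ 0 := hθ.1.ne'
    field_simp

lemma logEdgePoint_lt_one {θ : ℝ} (hθ : θ ∈ Ioo 0 Real.pi) : logEdgePoint θ < 1 := by
  have hm : θ / 2 ∈ Ioo 0 Real.pi := ⟨half_pos hθ.1, by linarith [hθ.1, hθ.2]⟩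
  refine (strictAntiOn_logEdgePoint hm hθ (half_lt_self hθ.1)).trans_le ?_
  refine ge_of_tendsto tendsto_logEdgePoint_zero ?_
  filter_upwards [Ioo_mem_nhdsGT hm.1] with t ht
  exact (strictAntiOn_logEdgePoint ⟨ht.1, ht.2.trans hm.2⟩ hm ht.2).le

lemma edgePoint_mem {θ : ℝ} (hθ : θ ∈ Ioo 0 Real.pi) : edgePoint θ ∈ Ioo 0 (Real.exp 1) :=
  ⟨Real.exp_pos _, Real.exp_lt_exp.2 (logEdgePoint_lt_one hθ)⟩

lemma tendsto_sin_mul_logEdgePoint_pi :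
    Tendsto (fun θ => Real.sin θ * logEdgePoint θ) (𝓝[<] Real.pi) (𝓝 (-Real.pi)) := by
  have hc : ContinuousAt (fun θ : ℝ => Real.sin θ * Real.log (Real.sin θ)
      - Real.sin θ * Real.log θ + θ * Real.cos θ) Real.pi := by
    have := Real.pi_pos.ne'
    have h := (Real.continuous_mul_log.comp Real.continuous_sin).continuousAt (x := Real.pi)
    have h2 := Real.continuousAt_log this
    exact (h.sub (Real.continuous_sin.continuousAt.mul h2)).add
      (continuousAt_id.mul Real.continuous_cos.continuousAt)
  have h := hc.tendsto.mono_left (nhdsWithin_le_nhds (s := Iio Real.pi))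
  simp only [Real.sin_pi, zero_mul, Real.cos_pi, sub_zero, zero_add, mul_neg, mul_one] at h
  refine h.congr' ?_
  filter_upwards [Ioo_mem_nhdsLT Real.pi_pos] with θ hθ
  have hs : Real.sin θ ≠ 0 := (Real.sin_pos_of_mem_Ioo hθ).ne'
  rw [logEdgePoint]
  field_simp

lemma tendsto_edgePoint_pi : Tendsto edgePoint (𝓝[<] Real.pi) (𝓝 0) := by
  refine Real.tendsto_exp_atBot.comp ?_
  have hs : Tendsto (fun θ => (Real.sin θ)⁻¹) (𝓝[<] Real.pi) atTop := by
    refine tendsto_inv_nhdsGT_zero.comp (tendsto_nhdsWithin_iff.2 ⟨?_, ?_⟩)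
    · have h := Real.continuous_sin.tendsto Real.pi
      rw [Real.sin_pi] at h
      exact h.mono_left nhdsWithin_le_nhds
    · filter_upwards [Ioo_mem_nhdsLT Real.pi_pos] with θ hθ
      exact Real.sin_pos_of_mem_Ioo hθ
  refine (tendsto_sin_mul_logEdgePoint_pi.neg_mul_atTop (neg_neg_of_pos Real.pi_pos) hs).congr' ?_
  filter_upwards [Ioo_mem_nhdsLT Real.pi_pos] with θ hθ
  have hs : Real.sin θ ≠ 0 := (Real.sin_pos_of_mem_Ioo hθ).ne'
  field_simp

lemma surjOn_edgePoint : SurjOn edgePoint (Ioo 0 Real.pi) (Ioo 0 (Real.exp 1)) := by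
  refine isPreconnected_Ioo.intermediate_value_Ioo (l₁ := 𝓝[<] Real.pi) (l₂ := 𝓝[>] 0)
    (le_principal_iff.2 (Ioo_mem_nhdsLT Real.pi_pos))
    (le_principal_iff.2 (Ioo_mem_nhdsGT Real.pi_pos)) ?_ tendsto_edgePoint_pi
    ((Real.continuous_exp.tendsto 1).comp tendsto_logEdgePoint_zero)
  exact fun θ hθ => ((Real.continuous_exp.continuousAt).comp
    (hasDerivAt_logEdgePoint hθ).continuousAt).continuousWithinAt

/-- The argument of the boundary value of `1 + f` at a point of `(0, e)`. -/
noncomputable def edgeAngle (x : ℝ) : ℝ := Function.invFunOn edgePoint (Ioo 0 Real.pi) x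

lemma edgeAngle_mem {x : ℝ} (hx : x ∈ Ioo 0 (Real.exp 1)) : edgeAngle x ∈ Ioo 0 Real.pi :=
  Function.invFunOn_mem (surjOn_edgePoint hx)

lemma edgePoint_edgeAngle {x : ℝ} (hx : x ∈ Ioo 0 (Real.exp 1)) :
    edgePoint (edgeAngle x) = x :=
  Function.invFunOn_eq (surjOn_edgePoint hx)

lemma edgeAngle_lt_iff {x θ : ℝ} (hx : x ∈ Ioo 0 (Real.exp 1)) (hθ : θ ∈ Ioo 0 Real.pi) :
    edgeAngle x < θ ↔ edgePoint θ < x := by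
  rw [← strictAntiOn_edgePoint.lt_iff_gt hθ (edgeAngle_mem hx), edgePoint_edgeAngle hx]

lemma lt_edgeAngle_iff {x θ : ℝ} (hx : x ∈ Ioo 0 (Real.exp 1)) (hθ : θ ∈ Ioo 0 Real.pi) :
    θ < edgeAngle x ↔ x < edgePoint θ := by
  rw [← strictAntiOn_edgePoint.lt_iff_gt (edgeAngle_mem hx) hθ, edgePoint_edgeAngle hx]

lemma continuousOn_edgeAngle : ContinuousOn edgeAngle (Ioo 0 (Real.exp 1)) := by
  intro x hx
  have hm := edgeAngle_mem hx
  refine tendsto_order.2 ⟨fun a ha => ?_, fun a ha => ?_⟩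
  · obtain ⟨b, hb, hb'⟩ := exists_between (max_lt ha hm.1)
    have hbm : b ∈ Ioo 0 Real.pi := ⟨(le_max_right _ _).trans_lt hb, hb'.trans hm.2⟩
    filter_upwards [self_mem_nhdsWithin,
      mem_nhdsWithin_of_mem_nhds (Iio_mem_nhds ((lt_edgeAngle_iff hx hbm).1 hb'))] with y hy hyb
    exact ((le_max_left _ _).trans_lt hb).trans ((lt_edgeAngle_iff hy hbm).2 hyb)
  · obtain ⟨b, hb, hb'⟩ := exists_between (lt_min ha hm.2)
    have hbm : b ∈ Ioo 0 Real.pi := ⟨hm.1.trans hb, hb'.trans_le (min_le_right _ _)⟩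
    filter_upwards [self_mem_nhdsWithin,
      mem_nhdsWithin_of_mem_nhds (Ioi_mem_nhds ((edgeAngle_lt_iff hx hbm).1 hb))] with y hy hyb
    exact ((edgeAngle_lt_iff hy hbm).2 hyb).trans (hb'.trans_le (min_le_left _ _))

lemma tendsto_edgeAngle_zero : Tendsto edgeAngle (𝓝[>] 0) (𝓝[<] Real.pi) := by
  have hI : ∀ᶠ x : ℝ in 𝓝[>] 0, x ∈ Ioo 0 (Real.exp 1) := Ioo_mem_nhdsGT (Real.exp_pos 1)
  refine tendsto_nhdsWithin_iff.2 ⟨tendsto_order.2 ⟨fun a ha => ?_, fun a ha => ?_⟩, ?_⟩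
  · obtain ⟨b, hb, hb'⟩ := exists_between (max_lt ha Real.pi_pos)
    have hbm : b ∈ Ioo 0 Real.pi := ⟨(le_max_right _ _).trans_lt hb, hb'⟩
    filter_upwards [hI, Ioo_mem_nhdsGT (edgePoint_mem hbm).1] with y hy hyb
    exact ((le_max_left _ _).trans_lt hb).trans ((lt_edgeAngle_iff hy hbm).2 hyb.2)
  · filter_upwards [hI] with y hy using (edgeAngle_mem hy).2.trans ha
  · filter_upwards [hI] with y hy using (edgeAngle_mem hy).2

lemma tendsto_edgeAngle_exp_one :
    Tendsto edgeAngle (𝓝[<] (Real.exp 1)) (𝓝[>] 0) := by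
  have hI : ∀ᶠ x : ℝ in 𝓝[<] (Real.exp 1), x ∈ Ioo 0 (Real.exp 1) :=
    Ioo_mem_nhdsLT (Real.exp_pos 1)
  refine tendsto_nhdsWithin_iff.2 ⟨tendsto_order.2 ⟨fun a ha => ?_, fun a ha => ?_⟩, ?_⟩
  · filter_upwards [hI] with y hy using ha.trans (edgeAngle_mem hy).1
  · obtain ⟨b, hb, hb'⟩ := exists_between (lt_min ha Real.pi_pos)
    have hbm : b ∈ Ioo 0 Real.pi := ⟨hb, hb'.trans_le (min_le_right _ _)⟩
    filter_upwards [hI, Ioo_mem_nhdsLT (edgePoint_mem hbm).2] with y hy hyb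
    exact ((edgeAngle_lt_iff hy hbm).2 hyb.1).trans (hb'.trans_le (min_le_left _ _))
  · filter_upwards [hI] with y hy using (edgeAngle_mem hy).1

/-- The density of the limiting distribution. -/
noncomputable def edgeDensity : ℝ → ℝ :=
  (Ioo 0 (Real.exp 1)).indicator
    fun x => Real.sin (edgeAngle x) ^ 2 / (Real.pi * edgeAngle x * x)

lemma edgeDensity_nonneg (x : ℝ) : 0 ≤ edgeDensity x := by
  refine indicator_nonneg (fun y hy => ?_) x
  have := (edgeAngle_mem hy).1
  have := hy.1
  have := Real.pi_pos
  positivity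

lemma continuousOn_edgeDensity : ContinuousOn edgeDensity (Ioo 0 (Real.exp 1)) := by
  refine ContinuousOn.congr ?_ (fun x hx => indicator_of_mem hx _)
  refine ((Real.continuous_sin.comp_continuousOn continuousOn_edgeAngle).pow 2).div
    ((continuousOn_const.mul continuousOn_edgeAngle).mul continuousOn_id) fun x hx => ?_
  exact mul_ne_zero (mul_ne_zero Real.pi_pos.ne' (edgeAngle_mem hx).1.ne') hx.1.ne'

lemma measurable_edgeDensity : Measurable edgeDensity := by
  have h : edgeDensity = (Ioo 0 (Real.exp 1)).indicator edgeDensity := by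
    rw [edgeDensity, indicator_indicator, inter_self]
  rw [h]
  rw [← piecewise_eq_indicator]
  exact continuousOn_edgeDensity.measurable_piecewise continuousOn_const measurableSet_Ioo

lemma tendsto_edgeDensity_zero :
    Tendsto (fun x => edgeDensity x * x * Real.log x ^ 2) (𝓝[>] 0) (𝓝 1) := by
  have hid : Tendsto (fun θ : ℝ => θ) (𝓝[<] Real.pi) (𝓝 Real.pi) :=
    tendsto_id.mono_left nhdsWithin_le_nhds
  have h := ((tendsto_sin_mul_logEdgePoint_pi.pow 2).div (hid.const_mul Real.pi)
    (mul_ne_zero Real.pi_pos.ne' Real.pi_pos.ne')).comp tendsto_edgeAngle_zero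
  have h1 : (-Real.pi) ^ 2 / (Real.pi * Real.pi) = 1 := by
    have := Real.pi_pos.ne'
    field_simp
  rw [h1] at h
  refine h.congr' ?_
  filter_upwards [Ioo_mem_nhdsGT (Real.exp_pos 1)] with x hx
  have hlog : Real.log x = logEdgePoint (edgeAngle x) := by
    rw [← Real.log_exp (logEdgePoint _)]
    exact congrArg Real.log (edgePoint_edgeAngle hx).symm
  have := (edgeAngle_mem hx).1.ne'
  have := Real.pi_pos.ne'
  have := hx.1.ne'
  simp only [Function.comp_apply, Pi.div_apply, edgeDensity, indicator_of_mem hx, hlog]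
  field_simp

lemma tendsto_exp_one_sub_edgePoint_div :
    Tendsto (fun θ => (Real.exp 1 - edgePoint θ) / θ ^ 2) (𝓝[>] 0) (𝓝 (Real.exp 1 / 2)) := by
  have hslope : Tendsto (fun t : ℝ => t⁻¹ * (Real.exp (1 + t) - Real.exp 1)) (𝓝[≠] 0)
      (𝓝 (Real.exp 1)) := by
    simpa using (Real.hasDerivAt_exp 1).tendsto_slope_zero
  have hu : Tendsto (fun θ => logEdgePoint θ - 1) (𝓝[>] 0) (𝓝[≠] 0) := by
    refine tendsto_nhdsWithin_iff.2 ⟨by simpa using tendsto_logEdgePoint_zero.sub_const 1, ?_⟩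
    filter_upwards [Ioo_mem_nhdsGT Real.pi_pos] with θ hθ
    exact (sub_neg.2 (logEdgePoint_lt_one hθ)).ne
  have h := (hslope.comp hu).mul tendsto_one_sub_logEdgePoint_div
  rw [mul_one_div] at h
  refine h.congr' ?_
  filter_upwards [Ioo_mem_nhdsGT Real.pi_pos] with θ hθ
  have h1 : logEdgePoint θ - 1 ≠ 0 := (sub_neg.2 (logEdgePoint_lt_one hθ)).ne
  have h0 : θ ≠ 0 := hθ.1.ne'
  simp only [Function.comp_apply, add_sub_cancel, edgePoint]
  field_simp
  ring

lemma tendsto_edgeDensity_exp_one :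
    ∃ C : ℝ, 0 < C ∧ Tendsto (fun x => edgeDensity x / Real.sqrt (Real.exp 1 - x))
      (𝓝[<] (Real.exp 1)) (𝓝 C) := by
  have he := Real.exp_pos 1
  have hpi := Real.pi_pos
  have hs : 0 < Real.sqrt (Real.exp 1 / 2) := Real.sqrt_pos.2 (half_pos he)
  refine ⟨1 ^ 2 * (Real.sqrt (Real.exp 1 / 2))⁻¹ / (Real.pi * Real.exp 1), by positivity, ?_⟩
  have h1 := ((tendsto_sin_div_nhdsGT_zero.pow 2).mul
    (((Real.continuous_sqrt.tendsto _).comp tendsto_exp_one_sub_edgePoint_div).inv₀ hs.ne')).comp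
    tendsto_edgeAngle_exp_one
  have hid : Tendsto (fun x : ℝ => Real.pi * x) (𝓝[<] (Real.exp 1))
      (𝓝 (Real.pi * Real.exp 1)) :=
    (tendsto_id.mono_left nhdsWithin_le_nhds).const_mul Real.pi
  refine (h1.div hid (mul_pos hpi he).ne').congr' ?_
  filter_upwards [Ioo_mem_nhdsLT he] with x hx
  have hθ := (edgeAngle_mem hx).1
  have := hx.1
  have hsq : 0 < Real.sqrt (Real.exp 1 - x) := Real.sqrt_pos.2 (sub_pos.2 hx.2)
  simp only [Function.comp_apply, Pi.div_apply, edgeDensity, indicator_of_mem hx,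
    edgePoint_edgeAngle hx, Real.sqrt_div (sub_pos.2 hx.2).le, Real.sqrt_sq hθ.le]
  field_simp

/-! ### Inverting `w ↦ w log w` on the closed upper half-plane -/

lemma continuousOn_mul_log_upper :
    ContinuousOn (fun w : ℂ => w * Complex.log w) {w | 0 ≤ w.im} := by
  intro w hw
  by_cases h0 : w = 0
  · subst h0
    refine ContinuousAt.continuousWithinAt ?_
    have hb : ∀ w : ℂ, ‖w * Complex.log w‖ ≤ |‖w‖ * Real.log ‖w‖| + ‖w‖ * Real.pi := by
      intro w
      rw [norm_mul, abs_mul, abs_norm, ← mul_add]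
      refine mul_le_mul_of_nonneg_left ((norm_le_abs_re_add_abs_im _).trans ?_) (norm_nonneg w)
      rw [Complex.log_re, Complex.log_im]
      gcongr
      exact abs_arg_le_pi w
    have hc : Continuous fun w : ℂ => |‖w‖ * Real.log ‖w‖| + ‖w‖ * Real.pi :=
      (Real.continuous_mul_log.comp continuous_norm).abs.add
        (continuous_norm.mul continuous_const)
    have := hc.tendsto 0
    simp only [norm_zero, zero_mul, abs_zero, add_zero] at this
    simpa [ContinuousAt] using squeeze_zero_norm hb this
  · refine continuousWithinAt_id.mul ?_
    by_cases hs : w ∈ slitPlane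
    · exact (continuousAt_clog hs).continuousWithinAt
    · rw [mem_slitPlane_iff] at hs
      push Not at hs
      refine continuousWithinAt_log_of_re_neg_of_im_zero (lt_of_le_of_ne hs.1 fun h => h0 ?_) hs.2
      exact Complex.ext h hs.2

lemma norm_le_max_norm_mul_log (w : ℂ) : ‖w‖ ≤ max (Real.exp 1) ‖w * Complex.log w‖ := by
  rcases le_total ‖w‖ (Real.exp 1) with h | h
  · exact h.trans (le_max_left _ _)
  · refine le_trans ?_ (le_max_right _ _)
    rw [norm_mul]
    refine le_mul_of_one_le_right (norm_nonneg w) ?_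
    have h1 : 1 ≤ Real.log ‖w‖ := (Real.le_log_iff_exp_le ((Real.exp_pos 1).trans_le h)).2 h
    calc 1 ≤ (Complex.log w).re := by rwa [Complex.log_re]
      _ ≤ ‖Complex.log w‖ := re_le_norm _

/-- The boundary value of `1 + f` at a point of `(0, e)`. -/
noncomputable def edgeValue (x : ℝ) : ℂ :=
  Complex.exp ((-(edgeAngle x * Real.cos (edgeAngle x) / Real.sin (edgeAngle x)) : ℝ)
    + edgeAngle x * I)

lemma edgeValue_im {x : ℝ} (hx : x ∈ Ioo 0 (Real.exp 1)) :
    (edgeValue x).im = Real.pi * edgeDensity x := by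
  have hm := edgeAngle_mem hx
  have hs := Real.sin_pos_of_mem_Ioo hm
  have h0 := hm.1
  have hpi := Real.pi_pos
  have hx' : x = Real.sin (edgeAngle x) / edgeAngle x
      * Real.exp (edgeAngle x * Real.cos (edgeAngle x) / Real.sin (edgeAngle x)) := by
    conv_lhs => rw [← edgePoint_edgeAngle hx]
    rw [edgePoint, logEdgePoint, Real.exp_add, Real.exp_sub, Real.exp_log hs, Real.exp_log h0]
  have hxp := hx.1
  rw [edgeDensity, indicator_of_mem hx, edgeValue, Complex.exp_im]
  simp only [add_re, ofReal_re, mul_re, I_re, mul_zero, ofReal_im, I_im, mul_one, sub_self,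
    add_zero, add_im, mul_im, zero_add, Real.exp_neg]
  set θ := edgeAngle x
  set E := Real.exp (θ * Real.cos θ / Real.sin θ) with hE
  have hEp : 0 < E := Real.exp_pos _
  rw [hx']
  field_simp

lemma neg_inv_exp_one_le_mul_log {r : ℝ} (hr : 0 < r) : -(Real.exp 1)⁻¹ ≤ r * Real.log r := by
  have he := Real.exp_pos 1
  have h := Real.add_one_le_exp (-1 - Real.log r)
  rw [Real.exp_sub, Real.exp_log hr, Real.exp_neg, le_div_iff₀ hr] at h
  linarith

lemma eq_edgeValue {w : ℂ} {x : ℝ} (hw : 0 ≤ w.im) (hx : x ∈ Ioo 0 (Real.exp 1))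
    (h : w * Complex.log w = -(x : ℂ)⁻¹) : w = edgeValue x := by
  have hx0 := hx.1
  have hw0 : w ≠ 0 := by
    rintro rfl
    simp [hx0.ne'] at h
  set r := ‖w‖ with hr
  set θ := arg w with hθ
  have hrp : 0 < r := norm_pos_iff.2 hw0
  have hre : w.re = r * Real.cos θ := (norm_mul_cos_arg w).symm
  have him : w.im = r * Real.sin θ := (norm_mul_sin_arg w).symm
  have hθ0 : 0 ≤ θ := arg_nonneg_iff.2 hw
  have hθpi : θ ≤ Real.pi := arg_le_pi w
  have h1 := congrArg Complex.re h
  have h2 := congrArg Complex.im h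
  rw [mul_re, log_re, log_im, hre, him, ← ofReal_inv, ← ofReal_neg, ofReal_re] at h1
  rw [mul_im, log_re, log_im, hre, him, ← ofReal_inv, ← ofReal_neg, ofReal_im] at h2
  rw [← hr, ← hθ] at h1 h2
  have hne0 : θ ≠ 0 := by
    intro h0
    rw [h0, Real.cos_zero, Real.sin_zero] at h1
    have := neg_inv_exp_one_le_mul_log hrp
    have hlt : (Real.exp 1)⁻¹ < x⁻¹ := (inv_lt_inv₀ (Real.exp_pos 1) hx0).2 hx.2
    linarith
  have hnepi : θ ≠ Real.pi := by
    intro h0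
    rw [h0, Real.cos_pi, Real.sin_pi] at h2
    have : r * Real.pi = 0 := by linarith
    exact (mul_pos hrp Real.pi_pos).ne' this
  have hm : θ ∈ Ioo 0 Real.pi := ⟨lt_of_le_of_ne hθ0 hne0.symm, lt_of_le_of_ne hθpi hnepi⟩
  have hs := Real.sin_pos_of_mem_Ioo hm
  have hlog : Real.log r = -(θ * Real.cos θ / Real.sin θ) := by
    have h3 : r * (θ * Real.cos θ + Real.log r * Real.sin θ) = 0 := by linarith
    have h4 := (mul_eq_zero.1 h3).resolve_left hrp.ne'
    field_simp
    linarith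
  have hθx : edgePoint θ = x := by
    have hr' : r * θ = x⁻¹ * Real.sin θ := by
      rw [hlog] at h1
      field_simp at h1
      have hsc := Real.sin_sq_add_cos_sq θ
      field_simp
      linear_combination (-1 : ℝ) * h1 - x * r * θ * hsc
    have hlogx : Real.log r + Real.log θ = -Real.log x + Real.log (Real.sin θ) := by
      rw [← Real.log_mul hrp.ne' hm.1.ne', hr', Real.log_mul (inv_pos.2 hx0).ne' hs.ne',
        Real.log_inv]
    rw [edgePoint, ← Real.exp_log hx0, logEdgePoint]
    congr 1
    linarith
  have hang : edgeAngle x = θ :=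
    strictAntiOn_edgePoint.injOn (edgeAngle_mem hx) hm
      ((edgePoint_edgeAngle hx).trans hθx.symm)
  rw [edgeValue, hang, ← hlog]
  exact (Complex.exp_log hw0).symm

lemma tendsto_edgeValue {α : Type*} {l : Filter α} {w : α → ℂ} {x : ℝ}
    (hx : x ∈ Ioo 0 (Real.exp 1)) (hw : ∀ᶠ t in l, 0 ≤ (w t).im)
    (h : Tendsto (fun t => w t * Complex.log (w t)) l (𝓝 (-(x : ℂ)⁻¹))) :
    Tendsto w l (𝓝 (edgeValue x)) := by
  obtain ⟨R, hR⟩ : ∃ R, ∀ᶠ t in l, ‖w t * Complex.log (w t)‖ ≤ R :=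
    ⟨_, h.norm.eventually_le_const (lt_add_one _)⟩
  have hclosed : IsClosed {w : ℂ | 0 ≤ w.im} := isClosed_le continuous_const continuous_im
  refine ((isCompact_closedBall (0 : ℂ) (max (Real.exp 1) R)).inter_right
    hclosed).tendsto_nhds_of_unique_mapClusterPt ?_ ?_
  · filter_upwards [hw, hR] with t ht htR
    exact ⟨mem_closedBall_zero_iff.2
      ((norm_le_max_norm_mul_log _).trans (max_le_max le_rfl htR)), ht⟩
  · intro v hv hcl
    obtain ⟨U, hU, hUv⟩ := mapClusterPt_iff_ultrafilter.1 hcl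
    refine eq_edgeValue hv.2 hx (tendsto_nhds_unique (f := fun t => w t * Complex.log (w t)) ?_
      (h.mono_left hU))
    exact (continuousOn_mul_log_upper v hv.2).tendsto.comp
      (tendsto_nhdsWithin_iff.2 ⟨hUv, hU hw⟩)

/-! ### Stieltjes inversion -/

lemma integrable_inv_sub (N : Measure ℝ) [IsFiniteMeasure N] (x : ℝ) {ε : ℝ} (hε : 0 < ε) :
    Integrable (fun l : ℝ => ((l : ℂ) - (x + ε * I))⁻¹) N := by
  have him (l : ℝ) : ((l : ℂ) - (x + ε * I)).im = -ε := by simp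
  have hne (l : ℝ) : ((l : ℂ) - (x + ε * I)) ≠ 0 := fun h => by
    have := him l
    rw [h, zero_im] at this
    linarith
  have hc : Continuous fun l : ℝ => ((l : ℂ) - (x + ε * I))⁻¹ :=
    (continuous_ofReal.sub continuous_const).inv₀ hne
  refine Integrable.of_bound hc.aestronglyMeasurable ε⁻¹ (Eventually.of_forall fun l => ?_)
  rw [norm_inv]
  refine inv_anti₀ hε ?_
  calc ε = |((l : ℂ) - (x + ε * I)).im| := by rw [him, abs_neg, abs_of_pos hε]
    _ ≤ _ := abs_im_le_norm _

lemma stieltjesTransform_im (N : Measure ℝ) [IsFiniteMeasure N] (x : ℝ) {ε : ℝ} (hε : 0 < ε) :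
    (stieltjesTransform N (x + ε * I)).im = ∫ l : ℝ, ε / ((l - x) ^ 2 + ε ^ 2) ∂N := by
  rw [stieltjesTransform]
  refine (integral_im (integrable_inv_sub N x hε)).symm.trans
    (integral_congr_ae (Eventually.of_forall fun l => ?_))
  simp [normSq_apply, pow_two]

lemma continuous_poisson {ε : ℝ} (hε : 0 < ε) :
    Continuous fun p : ℝ × ℝ => ε / ((p.2 - p.1) ^ 2 + ε ^ 2) := by
  refine Continuous.div (by fun_prop) (by fun_prop) fun p => ?_
  positivity

lemma integral_poisson (a b l : ℝ) {ε : ℝ} (hε : 0 < ε) :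
    ∫ x in a..b, ε / ((l - x) ^ 2 + ε ^ 2)
      = Real.arctan ((b - l) / ε) - Real.arctan ((a - l) / ε) := by
  refine intervalIntegral.integral_eq_sub_of_hasDerivAt
    (f := fun x => Real.arctan ((x - l) / ε)) (fun x _ => ?_) ?_
  · refine ((((hasDerivAt_id x).sub_const l).div_const ε).arctan).congr_deriv ?_
    simp only [id]
    have : (l - x) ^ 2 + ε ^ 2 ≠ 0 := by positivity
    have : 1 + ((x - l) / ε) ^ 2 ≠ 0 := by positivity
    field_simp
    ring
  · exact ((continuous_poisson hε).comp
      (by fun_prop : Continuous fun x : ℝ => (x, l))).intervalIntegrable a b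

lemma integral_stieltjesTransform_im (N : Measure ℝ) [IsFiniteMeasure N] {a b : ℝ} (hab : a ≤ b)
    {ε : ℝ} (hε : 0 < ε) :
    ∫ x in a..b, (stieltjesTransform N (x + ε * I)).im
      = ∫ l, (Real.arctan ((b - l) / ε) - Real.arctan ((a - l) / ε)) ∂N := by
  simp_rw [stieltjesTransform_im N _ hε, ← integral_poisson a b _ hε,
    intervalIntegral.integral_of_le hab]
  refine integral_integral_swap ?_
  refine Integrable.of_bound (continuous_poisson hε).aestronglyMeasurable ε⁻¹
    (Eventually.of_forall fun p => ?_)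
  rw [Function.uncurry, Real.norm_of_nonneg (by positivity), div_le_iff₀ (by positivity)]
  have : ε = ε⁻¹ * ε ^ 2 := by field_simp
  have h2 : 0 ≤ ε⁻¹ * (p.2 - p.1) ^ 2 := by positivity
  linarith

lemma tendsto_arctan_div_pos {c : ℝ} (hc : 0 < c) :
    Tendsto (fun ε => Real.arctan (c / ε)) (𝓝[>] 0) (𝓝 (Real.pi / 2)) := by
  have h : Tendsto (fun ε : ℝ => c / ε) (𝓝[>] 0) atTop := by
    simpa only [div_eq_mul_inv] using tendsto_inv_nhdsGT_zero.const_mul_atTop hc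
  exact (Real.tendsto_arctan_atTop.mono_right nhdsWithin_le_nhds).comp h

lemma tendsto_arctan_div_neg {c : ℝ} (hc : c < 0) :
    Tendsto (fun ε => Real.arctan (c / ε)) (𝓝[>] 0) (𝓝 (-(Real.pi / 2))) := by
  have h := (tendsto_arctan_div_pos (neg_pos.2 hc)).neg
  simpa [neg_div, Real.arctan_neg] using h

lemma tendsto_integral_stieltjesTransform_im (N : Measure ℝ) [IsFiniteMeasure N] {a b : ℝ}
    (hab : a ≤ b) (ha : N {a} = 0) (hb : N {b} = 0) :
    Tendsto (fun ε : ℝ => ∫ x in a..b, (stieltjesTransform N (x + ε * I)).im) (𝓝[>] 0)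
      (𝓝 (Real.pi * N.real (Ioo a b))) := by
  have hlim : Tendsto (fun ε : ℝ =>
      ∫ l, (Real.arctan ((b - l) / ε) - Real.arctan ((a - l) / ε)) ∂N) (𝓝[>] 0)
      (𝓝 (∫ l, (Ioo a b).indicator (fun _ => Real.pi) l ∂N)) := by
    refine tendsto_integral_filter_of_dominated_convergence (fun _ => Real.pi) ?_ ?_
      (integrable_const _) ?_
    · refine Eventually.of_forall fun ε => Continuous.aestronglyMeasurable ?_
      exact (Real.continuous_arctan.comp (by fun_prop)).sub
        (Real.continuous_arctan.comp (by fun_prop))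
    · refine Eventually.of_forall fun ε => Eventually.of_forall fun l => ?_
      rw [Real.norm_eq_abs, abs_le]
      have h1 := Real.arctan_lt_pi_div_two ((b - l) / ε)
      have h2 := Real.arctan_lt_pi_div_two ((a - l) / ε)
      have h3 := Real.neg_pi_div_two_lt_arctan ((b - l) / ε)
      have h4 := Real.neg_pi_div_two_lt_arctan ((a - l) / ε)
      constructor <;> linarith
    · have hae : ∀ᵐ l ∂N, l ≠ a := measure_eq_zero_iff_ae_notMem.1 ha
      have hbe : ∀ᵐ l ∂N, l ≠ b := measure_eq_zero_iff_ae_notMem.1 hb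
      filter_upwards [hae, hbe] with l hla hlb
      rcases hla.lt_or_gt with h1 | h1
      · rw [indicator_of_notMem (fun h => h1.not_gt h.1)]
        simpa using (tendsto_arctan_div_pos (sub_pos.2 (h1.trans_le hab))).sub
          (tendsto_arctan_div_pos (sub_pos.2 h1))
      · rcases hlb.lt_or_gt with h2 | h2
        · rw [indicator_of_mem (show l ∈ Ioo a b from ⟨h1, h2⟩)]
          have h := (tendsto_arctan_div_pos (sub_pos.2 h2)).sub
            (tendsto_arctan_div_neg (sub_neg.2 h1))
          rwa [sub_neg_eq_add, add_halves] at h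
        · rw [indicator_of_notMem (fun h => h2.not_gt h.2)]
          simpa using (tendsto_arctan_div_neg (sub_neg.2 h2)).sub
            (tendsto_arctan_div_neg (sub_neg.2 h1))
  rw [integral_indicator_const _ measurableSet_Ioo, smul_eq_mul, mul_comm] at hlim
  refine hlim.congr' ?_
  filter_upwards [self_mem_nhdsWithin] with ε hε
  exact (integral_stieltjesTransform_im N hab hε).symm

lemma measureReal_singleton_le_mul_stieltjesTransform_im (N : Measure ℝ) [IsFiniteMeasure N]
    (x : ℝ) {ε : ℝ} (hε : 0 < ε) :
    N.real {x} ≤ ε * (stieltjesTransform N (x + ε * I)).im := by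
  rw [stieltjesTransform_im N x hε, ← integral_const_mul]
  have hintegrable : Integrable (fun l : ℝ => ε * (ε / ((l - x) ^ 2 + ε ^ 2))) N := by
    refine Integrable.const_mul ?_ ε
    refine (integrable_inv_sub N x hε).im.congr (Eventually.of_forall fun l => ?_)
    simp [normSq_apply, pow_two]
  calc N.real {x} = ∫ l in {x}, ε * (ε / ((l - x) ^ 2 + ε ^ 2)) ∂N := by
        rw [integral_singleton]
        simp only [sub_self, ne_eq, OfNat.ofNat_ne_zero, not_false_eq_true, zero_pow, zero_add,
          smul_eq_mul]
        field_simp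
    _ ≤ _ := setIntegral_le_integral hintegrable (Eventually.of_forall fun l => by
        simp only [Pi.zero_apply]
        positivity)

/-! ### The limiting measure -/

lemma edgeDensity_le {x : ℝ} (hx : 0 < x) : edgeDensity x ≤ (Real.pi * x)⁻¹ := by
  have hpi := Real.pi_pos
  by_cases h : x ∈ Ioo 0 (Real.exp 1)
  · have hm := edgeAngle_mem h
    have hs := Real.sin_pos_of_mem_Ioo hm
    have h0 := hm.1
    have h1 : Real.sin (edgeAngle x) ^ 2 ≤ edgeAngle x := by
      nlinarith [Real.sin_le h0.le, Real.sin_le_one (edgeAngle x)]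
    rw [edgeDensity, indicator_of_mem h, inv_eq_one_div, div_le_div_iff₀ (by positivity)
      (by positivity)]
    nlinarith [mul_le_mul_of_nonneg_right h1 (mul_pos hpi hx).le]
  · rw [edgeDensity, indicator_of_notMem h]
    positivity

section

variable {N : Measure ℝ}

lemma stieltjesTransform_mul_log (heq : ∀ z ∈ cutPlane,
      (1 + stieltjesTransform N z) * Complex.log (1 + stieltjesTransform N z) = -z⁻¹)
    (x : ℝ) {ε : ℝ} (hε : 0 < ε) :
    (1 + stieltjesTransform N (x + ε * I)) * Complex.log (1 + stieltjesTransform N (x + ε * I))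
      = -(x + ε * I : ℂ)⁻¹ :=
  heq _ (Or.inl (by simpa using hε.ne'))

lemma norm_one_add_stieltjesTransform_le (heq : ∀ z ∈ cutPlane,
      (1 + stieltjesTransform N z) * Complex.log (1 + stieltjesTransform N z) = -z⁻¹)
    {x ε : ℝ} (hx : 0 < x) (hε : 0 < ε) :
    ‖1 + stieltjesTransform N (x + ε * I)‖ ≤ max (Real.exp 1) x⁻¹ := by
  refine (norm_le_max_norm_mul_log _).trans (max_le_max le_rfl ?_)
  rw [stieltjesTransform_mul_log heq x hε, norm_neg, norm_inv]
  refine inv_anti₀ hx ?_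
  calc x ≤ |(x + ε * I : ℂ).re| := by simpa using le_abs_self x
    _ ≤ _ := abs_re_le_norm _

lemma abs_stieltjesTransform_im_le (heq : ∀ z ∈ cutPlane,
      (1 + stieltjesTransform N z) * Complex.log (1 + stieltjesTransform N z) = -z⁻¹)
    {x ε : ℝ} (hx : 0 < x) (hε : 0 < ε) :
    |(stieltjesTransform N (x + ε * I)).im| ≤ max (Real.exp 1) x⁻¹ := by
  refine le_trans ?_ (norm_one_add_stieltjesTransform_le heq hx hε)
  simpa using abs_im_le_norm (1 + stieltjesTransform N (x + ε * I))

lemma tendsto_stieltjesTransform_im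
    (hclass : ∀ z : ℂ, z.im ≠ 0 → 0 ≤ (stieltjesTransform N z).im * z.im)
    (heq : ∀ z ∈ cutPlane,
      (1 + stieltjesTransform N z) * Complex.log (1 + stieltjesTransform N z) = -z⁻¹)
    {x : ℝ} (hx : x ∈ Ioo 0 (Real.exp 1)) :
    Tendsto (fun ε : ℝ => (stieltjesTransform N (x + ε * I)).im) (𝓝[>] 0)
      (𝓝 (Real.pi * edgeDensity x)) := by
  rw [← edgeValue_im hx]
  have hlim : Tendsto (fun ε : ℝ => 1 + stieltjesTransform N (x + ε * I)) (𝓝[>] 0)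
      (𝓝 (edgeValue x)) := by
    refine tendsto_edgeValue hx ?_ ?_
    · filter_upwards [self_mem_nhdsWithin] with ε (hε : 0 < ε)
      have h := hclass (x + ε * I) (by simpa using hε.ne')
      have hi : (x + ε * I : ℂ).im = ε := by simp
      rw [hi] at h
      simpa using nonneg_of_mul_nonneg_left h hε
    · have hz : Tendsto (fun ε : ℝ => (x + ε * I : ℂ)) (𝓝[>] 0) (𝓝 (x : ℂ)) := by
        have h : Continuous fun ε : ℝ => (x + ε * I : ℂ) := by fun_prop
        simpa using (h.tendsto 0).mono_left (nhdsWithin_le_nhds (s := Ioi 0))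
      refine (hz.inv₀ (ofReal_ne_zero.2 hx.1.ne')).neg.congr' ?_
      filter_upwards [self_mem_nhdsWithin] with ε hε
      exact (stieltjesTransform_mul_log heq x hε).symm
  simpa [Function.comp_def] using (continuous_im.tendsto _).comp hlim

variable [IsProbabilityMeasure N]

lemma measure_singleton_eq_zero_of_pos (heq : ∀ z ∈ cutPlane,
      (1 + stieltjesTransform N z) * Complex.log (1 + stieltjesTransform N z) = -z⁻¹)
    {x : ℝ} (hx : 0 < x) : N {x} = 0 := by
  have hlim : Tendsto (fun ε : ℝ => ε * max (Real.exp 1) x⁻¹) (𝓝[>] 0) (𝓝 0) := by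
    have h : Tendsto (fun ε : ℝ => ε * max (Real.exp 1) x⁻¹) (𝓝 0)
        (𝓝 (0 * max (Real.exp 1) x⁻¹)) := tendsto_id.mul_const _
    rw [zero_mul] at h
    exact h.mono_left nhdsWithin_le_nhds
  have hle : N.real {x} ≤ 0 := by
    refine ge_of_tendsto hlim ?_
    filter_upwards [self_mem_nhdsWithin] with ε (hε : 0 < ε)
    refine (measureReal_singleton_le_mul_stieltjesTransform_im N x hε).trans ?_
    exact mul_le_mul_of_nonneg_left
      ((le_abs_self _).trans (abs_stieltjesTransform_im_le heq hx hε)) hε.le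
  exact (measureReal_eq_zero_iff).1 (le_antisymm hle measureReal_nonneg)

lemma measure_singleton_zero_eq_zero (heq : ∀ z ∈ cutPlane,
      (1 + stieltjesTransform N z) * Complex.log (1 + stieltjesTransform N z) = -z⁻¹) :
    N {0} = 0 := by
  by_contra hne
  set c := N.real {0} with hc
  have hcp : 0 < c := lt_of_le_of_ne measureReal_nonneg fun h =>
    hne ((measureReal_eq_zero_iff).1 h.symm)
  set ε := c / Real.exp (1 / c + 1) with hε
  have hεp : 0 < ε := by positivity
  have hcε : c / ε = Real.exp (1 / c + 1) := by
    rw [hε]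
    field_simp
  have hmul := stieltjesTransform_mul_log heq 0 hεp
  have him := measureReal_singleton_le_mul_stieltjesTransform_im N 0 hεp
  rw [← hc] at him
  set w := 1 + stieltjesTransform N ((0 : ℝ) + ε * I) with hw
  have hwim : (stieltjesTransform N ((0 : ℝ) + ε * I)).im ≤ ‖w‖ := by
    refine le_trans (le_of_eq ?_) (im_le_norm w)
    simp [hw]
  have hwn : Real.exp (1 / c + 1) ≤ ‖w‖ := by
    rw [← hcε, div_le_iff₀' hεp]
    exact him.trans (mul_le_mul_of_nonneg_left hwim hεp.le)
  have hlog : 1 / c + 1 ≤ ‖Complex.log w‖ := by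
    calc 1 / c + 1 ≤ Real.log ‖w‖ :=
          (Real.le_log_iff_exp_le ((Real.exp_pos _).trans_le hwn)).2 hwn
      _ = (Complex.log w).re := (Complex.log_re w).symm
      _ ≤ _ := re_le_norm _
  have hnorm : ‖w‖ * ‖Complex.log w‖ = ε⁻¹ := by
    rw [← norm_mul, hmul]
    simp [abs_of_pos hεp]
  have hlow : c / ε * (1 / c + 1) ≤ ε⁻¹ := by
    rw [← hnorm, hcε]
    exact mul_le_mul hwn hlog (by positivity) (norm_nonneg w)
  have heq' : c / ε * (1 / c + 1) = ε⁻¹ + c * ε⁻¹ := by field_simp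
  have : 0 < c * ε⁻¹ := by positivity
  linarith

lemma measure_Ioo_eq_of_pos
    (hclass : ∀ z : ℂ, z.im ≠ 0 → 0 ≤ (stieltjesTransform N z).im * z.im)
    (heq : ∀ z ∈ cutPlane,
      (1 + stieltjesTransform N z) * Complex.log (1 + stieltjesTransform N z) = -z⁻¹)
    {a b : ℝ} (ha : 0 < a) (hab : a ≤ b) (hb : b ≤ Real.exp 1) :
    N (Ioo a b) = volume.withDensity (fun x => ENNReal.ofReal (edgeDensity x)) (Ioo a b) := by
  have hpi := Real.pi_pos
  have hlim : Tendsto (fun ε : ℝ => ∫ x in a..b, (stieltjesTransform N (x + ε * I)).im) (𝓝[>] 0)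
      (𝓝 (∫ x in a..b, Real.pi * edgeDensity x)) := by
    refine intervalIntegral.tendsto_integral_filter_of_dominated_convergence
      (fun _ => max (Real.exp 1) a⁻¹) ?_ ?_ intervalIntegrable_const ?_
    · filter_upwards [self_mem_nhdsWithin] with ε hε
      simp_rw [stieltjesTransform_im N _ hε]
      exact ((continuous_poisson hε).stronglyMeasurable.integral_prod_right
        (ν := N)).aestronglyMeasurable
    · filter_upwards [self_mem_nhdsWithin] with ε hε
      refine Eventually.of_forall fun x hx => ?_
      rw [uIoc_of_le hab] at hx
      refine (abs_stieltjesTransform_im_le heq (ha.trans hx.1) hε).trans (max_le_max le_rfl ?_)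
      exact inv_anti₀ ha hx.1.le
    · have hne : ∀ᵐ x : ℝ, x ≠ b := Measure.ae_ne volume b
      filter_upwards [hne] with x hxb hx
      rw [uIoc_of_le hab] at hx
      exact tendsto_stieltjesTransform_im hclass heq
        ⟨ha.trans hx.1, (lt_of_le_of_ne hx.2 hxb).trans_le hb⟩
  have hval := tendsto_nhds_unique (tendsto_integral_stieltjesTransform_im N hab
    (measure_singleton_eq_zero_of_pos heq ha)
    (measure_singleton_eq_zero_of_pos heq (ha.trans_le hab))) hlim
  rw [intervalIntegral.integral_const_mul, mul_right_inj' hpi.ne',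
    intervalIntegral.integral_of_le hab, integral_Ioc_eq_integral_Ioo] at hval
  have hintegrable : IntegrableOn edgeDensity (Ioo a b) := by
    refine Measure.integrableOn_of_bounded (M := (Real.pi * a)⁻¹) measure_Ioo_lt_top.ne
      measurable_edgeDensity.aestronglyMeasurable ?_
    filter_upwards [ae_restrict_mem measurableSet_Ioo] with x hx
    rw [Real.norm_of_nonneg (edgeDensity_nonneg x)]
    exact (edgeDensity_le (ha.trans hx.1)).trans
      (inv_anti₀ (by positivity) (mul_le_mul_of_nonneg_left hx.1.le hpi.le))
  rw [withDensity_apply _ measurableSet_Ioo,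
    ← ofReal_integral_eq_lintegral_ofReal hintegrable (Eventually.of_forall edgeDensity_nonneg),
    ← hval, ofReal_measureReal]

lemma measure_Ioo_eq
    (hclass : ∀ z : ℂ, z.im ≠ 0 → 0 ≤ (stieltjesTransform N z).im * z.im)
    (heq : ∀ z ∈ cutPlane,
      (1 + stieltjesTransform N z) * Complex.log (1 + stieltjesTransform N z) = -z⁻¹)
    {a b : ℝ} (ha : 0 ≤ a) (hb : b ≤ Real.exp 1) :
    N (Ioo a b) = volume.withDensity (fun x => ENNReal.ofReal (edgeDensity x)) (Ioo a b) := by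
  rcases le_or_gt b a with hab | hab
  · simp [Ioo_eq_empty_of_le hab]
  obtain ⟨u, hu, hmem, hlim⟩ := exists_seq_strictAnti_tendsto' hab
  have hmono : Monotone fun n => Ioo (u n) b := fun m n hmn =>
    Ioo_subset_Ioo_left (hu.antitone hmn)
  have hU : Ioo a b = ⋃ n, Ioo (u n) b := by
    refine Subset.antisymm (fun x hx => ?_)
      (iUnion_subset fun n => Ioo_subset_Ioo_left (hmem n).1.le)
    obtain ⟨n, hn⟩ := (hlim.eventually_lt_const hx.1).exists
    exact mem_iUnion.2 ⟨n, hn, hx.2⟩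
  rw [hU, hmono.measure_iUnion, hmono.measure_iUnion]
  exact iSup_congr fun n =>
    measure_Ioo_eq_of_pos hclass heq (ha.trans_lt (hmem n).1) (hmem n).2.le hb

lemma eq_withDensity_edgeDensity (hsupp : N (Set.Icc 0 (Real.exp 1))ᶜ = 0)
    (hclass : ∀ z : ℂ, z.im ≠ 0 → 0 ≤ (stieltjesTransform N z).im * z.im)
    (heq : ∀ z ∈ cutPlane,
      (1 + stieltjesTransform N z) * Complex.log (1 + stieltjesTransform N z) = -z⁻¹) :
    N = volume.withDensity (fun x => ENNReal.ofReal (edgeDensity x)) := by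
  set ν := volume.withDensity (fun x => ENNReal.ofReal (edgeDensity x)) with hν
  have hN : N (Ioo 0 (Real.exp 1))ᶜ = 0 := by
    refine measure_mono_null (t := (Icc 0 (Real.exp 1))ᶜ ∪ ({0} ∪ {Real.exp 1})) ?_
      (measure_union_null hsupp (measure_union_null (measure_singleton_zero_eq_zero heq)
        (measure_singleton_eq_zero_of_pos heq (Real.exp_pos 1))))
    intro x hx
    by_contra hc
    simp only [mem_union, mem_compl_iff, mem_singleton_iff, not_or, not_not] at hc
    exact hx ⟨lt_of_le_of_ne hc.1.1 (Ne.symm hc.2.1), lt_of_le_of_ne hc.1.2 hc.2.2⟩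
  have hνc : ν (Ioo 0 (Real.exp 1))ᶜ = 0 := by
    rw [hν, withDensity_apply _ measurableSet_Ioo.compl]
    refine (setLIntegral_congr_fun measurableSet_Ioo.compl fun x hx => ?_).trans lintegral_zero
    simp [edgeDensity, indicator_of_notMem hx]
  have hsing : ∀ b, ν {b} = 0 := fun b =>
    withDensity_absolutelyContinuous volume _ Real.volume_singleton
  refine Measure.ext_of_Ioc N ν fun a b hab => ?_
  have hNb : N {b} = 0 := by
    by_cases hb : 0 < b
    · exact measure_singleton_eq_zero_of_pos heq hb
    · refine measure_mono_null (singleton_subset_iff.2 ?_) hN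
      exact fun h => hb h.1
  rw [← measure_congr (Ioo_ae_eq_Ioc' hNb), ← measure_congr (Ioo_ae_eq_Ioc' (hsing b)),
    ← measure_inter_conull hN, ← measure_inter_conull hνc, Ioo_inter_Ioo]
  exact measure_Ioo_eq hclass heq le_sup_right inf_le_right

end

/-- Theorem 1.4(iii): the probability measure `N` supported on `[0, e]`
whose Stieltjes transform satisfies `(1 + f)Log(1 + f) = −1/z` is absolutely continuous with
a density `ρ` continuous on `(0, e)`, with edge asymptotics
`ρ(λ) = (1 + o(1))/(λ (ln λ)²)` as `λ ↓ 0` and `ρ(λ) = C(e − λ)^{1/2}(1 + o(1))` as `λ ↑ e`. -/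
theorem triangular_density_edge_asymptotics
    (N : Measure ℝ) [IsProbabilityMeasure N]
    (hsupp : N (Set.Icc 0 (Real.exp 1))ᶜ = 0)
    (hclass : ∀ z : ℂ, z.im ≠ 0 → 0 ≤ (stieltjesTransform N z).im * z.im)
    (heq : ∀ z ∈ cutPlane,
      (1 + stieltjesTransform N z) * Complex.log (1 + stieltjesTransform N z) = -z⁻¹) :
    ∃ ρ : ℝ → ℝ, (∀ l, 0 ≤ ρ l) ∧
      N = volume.withDensity (fun l => ENNReal.ofReal (ρ l)) ∧
      ContinuousOn ρ (Set.Ioo 0 (Real.exp 1)) ∧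
      Tendsto (fun l => ρ l * l * (Real.log l) ^ 2) (nhdsWithin 0 (Set.Ioi 0)) (nhds 1) ∧
      ∃ C : ℝ, 0 < C ∧
        Tendsto (fun l => ρ l / Real.sqrt (Real.exp 1 - l))
          (nhdsWithin (Real.exp 1) (Set.Iio (Real.exp 1))) (nhds C) := by
  exact ⟨edgeDensity, edgeDensity_nonneg, eq_withDensity_edgeDensity hsupp hclass heq,
    continuousOn_edgeDensity, tendsto_edgeDensity_zero, tendsto_edgeDensity_exp_one⟩
end

section
/- For every real x > e the series Σ_{k=0}^{∞} (k^k/(k+1)!)·x^{−k−1} converges (with the convention 0⁰ = 1), the number s(x) := 1 − Σ_{k=0}^{∞} (k^k/(k+1)!)·x^{−k−1} lies in (e^{−1}, 1), and it satisfies s(x)·ln s(x) = −1/x. -/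
open Set Filter

/-- The `n`-th finite difference of `x ↦ x ^ n`, written as a sum over the antidiagonal. -/
lemma sum_antidiagonal_pow_self_mul_neg_pow (n : ℕ) :
    ∑ p ∈ Finset.HasAntidiagonal.antidiagonal n,
      ((p.1 : ℝ) ^ p.1 / p.1.factorial) * ((-(p.1 : ℝ)) ^ p.2 / p.2.factorial) = 1 := by
  have h := congrFun (fwdDiff_iter_eq_factorial (R := ℝ) (n := n)) 0
  rw [fwdDiff_iter_eq_sum_shift] at h
  have hn : (n.factorial : ℝ) ≠ 0 := by positivity
  rw [Finset.Nat.sum_antidiagonal_eq_sum_range_succ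
    (fun i j => ((i : ℝ) ^ i / i.factorial) * ((-(i : ℝ)) ^ j / j.factorial)),
    ← mul_right_inj' hn, mul_one, Finset.mul_sum]
  refine Eq.trans (Finset.sum_congr rfl fun k hk => ?_) h
  have hk : k ≤ n := Nat.lt_succ_iff.mp (Finset.mem_range.mp hk)
  rw [neg_pow (k : ℝ)]
  have hp : (k : ℝ) ^ n = k ^ k * k ^ (n - k) := by rw [← pow_add, Nat.add_sub_cancel' hk]
  simp only [zero_add, nsmul_eq_mul, mul_one, zsmul_eq_mul, hp]
  push_cast
  rw [Nat.cast_choose ℝ hk]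
  field_simp

lemma pow_self_div_factorial_le (k : ℕ) : (k : ℝ) ^ k / k.factorial ≤ Real.exp 1 ^ k := by
  rw [← Real.exp_nat_mul, mul_one]
  exact Real.pow_div_factorial_le_exp _ k.cast_nonneg k

lemma norm_pow_self_div_factorial_mul_pow_le (k : ℕ) (y : ℝ) :
    ‖(k : ℝ) ^ k / k.factorial * y ^ k‖ ≤ (Real.exp 1 * |y|) ^ k := by
  rw [norm_mul, norm_pow, Real.norm_eq_abs y, mul_pow, Real.norm_of_nonneg (by positivity)]
  gcongr
  exact pow_self_div_factorial_le k

lemma ofScalars_pow_self_div_factorial_radius :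
    ENNReal.ofReal (Real.exp (-1)) ≤
      (FormalMultilinearSeries.ofScalars ℝ fun k : ℕ => (k : ℝ) ^ k / k.factorial).radius := by
  refine FormalMultilinearSeries.le_radius_of_bound _ 1 fun n => ?_
  rw [FormalMultilinearSeries.ofScalars_norm, Real.norm_of_nonneg (by positivity),
    Real.coe_toNNReal _ (Real.exp_pos _).le]
  calc _ ≤ Real.exp 1 ^ n * Real.exp (-1) ^ n := by
        gcongr
        exact pow_self_div_factorial_le n
    _ = 1 := by rw [← mul_pow, ← Real.exp_add]; simp

lemma analyticAt_tsum_pow_self_div_factorial {y : ℝ} (hy : |y| < Real.exp (-1)) :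
    AnalyticAt ℝ (fun z : ℝ => ∑' k : ℕ, (k : ℝ) ^ k / k.factorial * z ^ k) y := by
  have hr := ofScalars_pow_self_div_factorial_radius
  have h := (FormalMultilinearSeries.ofScalars ℝ
    fun k : ℕ => (k : ℝ) ^ k / k.factorial).hasFPowerSeriesOnBall
      (lt_of_lt_of_le (by simpa using Real.exp_pos _) hr)
  have h' := h.analyticAt_of_mem (y := y) (by
    refine Metric.eball_subset_eball hr ?_
    rw [Metric.eball_ofReal]
    simpa using hy)
  refine h'.congr (Eventually.of_forall fun z => ?_)
  exact FormalMultilinearSeries.ofScalars_sum_eq _ z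

lemma exp_two_lt_ten : Real.exp 2 < 10 := by
  have h : Real.exp 2 = Real.exp 1 ^ 2 := by rw [← Real.exp_nat_mul]; norm_num
  have := Real.exp_one_lt_d9
  nlinarith [Real.exp_pos 1]

lemma exp_one_mul_abs_mul_exp_abs_lt_one {w : ℝ} (hw : |w| < 1 / 10) :
    Real.exp 1 * (|w| * Real.exp |w|) < 1 := by
  have h1 : Real.exp 1 * Real.exp |w| ≤ Real.exp 2 := by
    rw [← Real.exp_add]
    exact Real.exp_le_exp.mpr (by linarith)
  nlinarith [exp_two_lt_ten, abs_nonneg w, Real.exp_pos 2]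

/-- Near `0` the identity follows by expanding `e^{-kw}` and summing along antidiagonals. -/
lemma tsum_pow_self_div_factorial_of_abs_lt {w : ℝ} (hw : |w| < 1 / 10) :
    ∑' k : ℕ, (k : ℝ) ^ k / k.factorial * (w * Real.exp (-w)) ^ k = (1 - w)⁻¹ := by
  set f : ℕ × ℕ → ℝ := fun p =>
    ((p.1 : ℝ) ^ p.1 / p.1.factorial * w ^ p.1) * ((p.1 * -w) ^ p.2 / p.2.factorial) with hf
  have hexp (t : ℝ) : HasSum (fun j : ℕ => t ^ j / j.factorial) (Real.exp t) := by
    rw [Real.exp_eq_exp_ℝ]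
    exact NormedSpace.expSeries_div_hasSum_exp t
  have hrow (k : ℕ) : HasSum (fun j => f (k, j))
      ((k : ℝ) ^ k / k.factorial * (w * Real.exp (-w)) ^ k) := by
    rw [mul_pow, ← Real.exp_nat_mul, ← mul_assoc]
    exact (hexp _).mul_left _
  have hrow_norm (k : ℕ) : HasSum (fun j => ‖f (k, j)‖)
      ((k : ℝ) ^ k / k.factorial * (|w| * Real.exp |w|) ^ k) := by
    rw [mul_pow, ← Real.exp_nat_mul, ← mul_assoc]
    convert! (hexp (k * |w|)).mul_left ((k : ℝ) ^ k / k.factorial * |w| ^ k) using 2 with j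
    simp [hf]
  have hsum : Summable f := by
    refine Summable.of_norm ((summable_prod_of_nonneg fun _ => norm_nonneg _).mpr
      ⟨fun k => (hrow_norm k).summable, ?_⟩)
    simp only [(hrow_norm _).tsum_eq]
    refine Summable.of_norm_bounded (summable_geometric_of_lt_one (by positivity)
      (exp_one_mul_abs_mul_exp_abs_lt_one hw)) fun k => ?_
    refine (norm_pow_self_div_factorial_mul_pow_le k _).trans_eq ?_
    rw [abs_of_nonneg (a := |w| * _) (by positivity)]
  have hanti : HasSum (fun n : ℕ => w ^ n) (∑' p, f p) := by
    refine HasSum.sigma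
      (Finset.HasAntidiagonal.sigmaAntidiagonalEquivProd.hasSum_iff.mpr hsum.hasSum) fun n => ?_
    convert! hasSum_fintype _ using 1
    rw [Finset.univ_eq_attach]
    simp only [Function.comp_apply, Finset.HasAntidiagonal.sigmaAntidiagonalEquivProd_apply]
    rw [Finset.sum_attach (Finset.HasAntidiagonal.antidiagonal n) f, ← mul_one (w ^ n),
      ← sum_antidiagonal_pow_self_mul_neg_pow n, Finset.mul_sum]
    refine Finset.sum_congr rfl fun p hp => ?_
    rw [← Finset.HasAntidiagonal.mem_antidiagonal.mp hp, hf]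
    simp only [mul_neg, ← neg_mul, mul_pow, pow_add]
    ring
  rw [(hsum.hasSum.prod_fiberwise hrow).tsum_eq]
  exact hanti.unique (hasSum_geometric_of_abs_lt_one (hw.trans (by norm_num)))

lemma mul_exp_neg_lt_exp_neg_one {w : ℝ} (hw : w < 1) : w * Real.exp (-w) < Real.exp (-1) := by
  have h : w < Real.exp (w - 1) := by
    linarith [Real.add_one_lt_exp (sub_ne_zero.mpr hw.ne)]
  calc w * Real.exp (-w) < Real.exp (w - 1) * Real.exp (-w) := by gcongr
    _ = Real.exp (-1) := by rw [← Real.exp_add]; ring_nf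

lemma abs_mul_exp_neg_lt {w : ℝ} (hw : w ∈ Ioo (-(1 / 10)) 1) :
    |w * Real.exp (-w)| < Real.exp (-1) := by
  rcases le_or_gt 0 w with h | h
  · rw [abs_of_nonneg (by positivity)]
    exact mul_exp_neg_lt_exp_neg_one hw.2
  · rw [abs_mul, Real.abs_exp, ← abs_of_neg h, Real.exp_neg 1, ← one_div,
      lt_div_iff₀' (Real.exp_pos _)]
    exact exp_one_mul_abs_mul_exp_abs_lt_one (by rw [abs_of_neg h]; linarith [hw.1])

/-- `∑ k^k/k! · (w e^{-w})^k = 1/(1-w)`, by analytic continuation from a neighbourhood of `0`. -/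
lemma tsum_pow_self_div_factorial {w : ℝ} (hw : w ∈ Ioo (-(1 / 10)) 1) :
    ∑' k : ℕ, (k : ℝ) ^ k / k.factorial * (w * Real.exp (-w)) ^ k = (1 - w)⁻¹ := by
  have hleft : AnalyticOnNhd ℝ
      (fun w : ℝ => ∑' k : ℕ, (k : ℝ) ^ k / k.factorial * (w * Real.exp (-w)) ^ k)
      (Ioo (-(1 / 10)) 1) := fun v hv =>
    (analyticAt_tsum_pow_self_div_factorial (abs_mul_exp_neg_lt hv)).fun_comp
      (f := fun v => v * Real.exp (-v)) (by fun_prop)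
  have hright : AnalyticOnNhd ℝ (fun w : ℝ => (1 - w)⁻¹) (Ioo (-(1 / 10)) 1) := fun v hv =>
    AnalyticAt.inv (by fun_prop) (sub_pos.mpr hv.2).ne'
  refine hleft.eqOn_of_preconnected_of_eventuallyEq hright isPreconnected_Ioo
    (z₀ := 0) (by norm_num) ?_ hw
  filter_upwards [Metric.ball_mem_nhds (0 : ℝ) (by norm_num : (0 : ℝ) < 1 / 10)] with v hv
  exact tsum_pow_self_div_factorial_of_abs_lt (by simpa using hv)

lemma norm_pow_self_div_factorial_succ_mul_pow_le (k : ℕ) (y : ℝ) :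
    ‖(k : ℝ) ^ k / (k + 1).factorial * y ^ (k + 1)‖ ≤ |y| * (Real.exp 1 * |y|) ^ k := by
  have h : ‖(k : ℝ) ^ k / (k + 1).factorial * y ^ (k + 1)‖ ≤
      |y| * ‖(k : ℝ) ^ k / k.factorial * y ^ k‖ := by
    simp only [norm_mul, norm_div, norm_pow, Real.norm_eq_abs, Nat.abs_cast, pow_succ]
    rw [mul_comm |y|, mul_assoc]
    gcongr
    exact Nat.le_succ k
  exact h.trans (by gcongr; exact norm_pow_self_div_factorial_mul_pow_le k y)

lemma exp_one_mul_lt_one {y : ℝ} (hy : y < Real.exp (-1)) : Real.exp 1 * y < 1 := by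
  rwa [← lt_div_iff₀' (Real.exp_pos _), one_div, ← Real.exp_neg]

lemma summable_pow_self_div_factorial_succ {y : ℝ} (hy : |y| < Real.exp (-1)) :
    Summable fun k : ℕ => (k : ℝ) ^ k / (k + 1).factorial * y ^ (k + 1) :=
  .of_norm_bounded ((summable_geometric_of_lt_one (by positivity)
    (exp_one_mul_lt_one hy)).mul_left |y|) (norm_pow_self_div_factorial_succ_mul_pow_le · y)

lemma hasDerivAt_tsum_pow_self_div_factorial_succ {y : ℝ} (hy : |y| < Real.exp (-1)) :
    HasDerivAt (fun z : ℝ => ∑' k : ℕ, (k : ℝ) ^ k / (k + 1).factorial * z ^ (k + 1))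
      (∑' k : ℕ, (k : ℝ) ^ k / k.factorial * y ^ k) y := by
  obtain ⟨r, hyr, hr⟩ := exists_between hy
  have hr0 : 0 < r := (abs_nonneg y).trans_lt hyr
  refine hasDerivAt_tsum_of_isPreconnected (t := Metric.ball 0 r) (y₀ := y)
    (g' := fun (k : ℕ) z => (k : ℝ) ^ k / k.factorial * z ^ k)
    (summable_geometric_of_lt_one (by positivity) (exp_one_mul_lt_one hr)) Metric.isOpen_ball
    (convex_ball 0 r).isPreconnected (fun k z _ => ?_) (fun k z hz => ?_) (by simpa using hyr)
    (summable_pow_self_div_factorial_succ hy) (by simpa using hyr)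
  · convert! (hasDerivAt_pow (k + 1) z).const_mul ((k : ℝ) ^ k / (Nat.factorial (k + 1) : ℝ)) using 1
    rw [Nat.factorial_succ]
    push_cast
    field_simp
  · refine (norm_pow_self_div_factorial_mul_pow_le k z).trans ?_
    have hz : |z| < r := by simpa using hz
    gcongr

lemma tsum_pow_self_div_factorial_succ {w : ℝ} (hw : w ∈ Ioo (-(1 / 10)) 1) :
    ∑' k : ℕ, (k : ℝ) ^ k / (k + 1).factorial * (w * Real.exp (-w)) ^ (k + 1) =
      1 - Real.exp (-w) := by
  have hinner (v : ℝ) : HasDerivAt (fun v : ℝ => Real.exp (-v)) (-Real.exp (-v)) v := by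
    simpa using (hasDerivAt_neg v).exp
  have hleft {v : ℝ} (hv : v ∈ Ioo (-(1 / 10)) 1) : HasDerivAt
      (fun v : ℝ => ∑' k : ℕ, (k : ℝ) ^ k / (k + 1).factorial * (v * Real.exp (-v)) ^ (k + 1))
      (Real.exp (-v)) v := by
    convert! (hasDerivAt_tsum_pow_self_div_factorial_succ (abs_mul_exp_neg_lt hv)).comp v
      ((hasDerivAt_id v).mul (hinner v)) using 1
    rw [tsum_pow_self_div_factorial hv]
    have : 1 - v ≠ 0 := (sub_pos.mpr hv.2).ne'
    simp only [id]
    field_simp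
    ring
  have hright (v : ℝ) : HasDerivAt (fun v : ℝ => 1 - Real.exp (-v)) (Real.exp (-v)) v := by
    simpa using (hinner v).const_sub 1
  refine isOpen_Ioo.eqOn_of_deriv_eq (x := 0) isPreconnected_Ioo
    (fun v hv => (hleft hv).differentiableAt.differentiableWithinAt)
    (fun v _ => (hright v).differentiableAt.differentiableWithinAt)
    (fun v hv => (hleft hv).deriv.trans (hright v).deriv.symm) (by norm_num) (by simp) hw

lemma exists_mul_exp_neg_eq {y : ℝ} (hy : y ∈ Ioo 0 (Real.exp (-1))) :
    ∃ w ∈ Ioo (0 : ℝ) 1, w * Real.exp (-w) = y :=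
  intermediate_value_Ioo zero_le_one (f := fun w : ℝ => w * Real.exp (-w))
    (by fun_prop) (by simpa using hy)

/-- for `x > e` the moment series `Σ_k (k^k/(k+1)!)·x^{−k−1}` converges
(with `0⁰ = 1`), the number `s(x) = 1 − Σ_k (k^k/(k+1)!)·x^{−k−1}` lies in `(e⁻¹, 1)`, and
satisfies `s(x)·ln s(x) = −1/x`. -/
theorem triangular_moment_series (x : ℝ) (hx : Real.exp 1 < x) :
    Summable (fun k : ℕ => ((k : ℝ) ^ k / (Nat.factorial (k + 1) : ℝ)) / x ^ (k + 1)) ∧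
    (1 - ∑' k : ℕ, ((k : ℝ) ^ k / (Nat.factorial (k + 1) : ℝ)) / x ^ (k + 1))
      ∈ Ioo (Real.exp 1)⁻¹ 1 ∧
    (1 - ∑' k : ℕ, ((k : ℝ) ^ k / (Nat.factorial (k + 1) : ℝ)) / x ^ (k + 1)) *
        Real.log (1 - ∑' k : ℕ, ((k : ℝ) ^ k / (Nat.factorial (k + 1) : ℝ)) / x ^ (k + 1))
      = -1 / x := by
  have hx0 : 0 < x := (Real.exp_pos 1).trans hx
  have hlt : x⁻¹ < Real.exp (-1) := by
    rw [Real.exp_neg]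
    exact inv_strictAnti₀ (Real.exp_pos 1) hx
  have hterm (k : ℕ) : ((k : ℝ) ^ k / (Nat.factorial (k + 1) : ℝ)) / x ^ (k + 1) =
      (k : ℝ) ^ k / (k + 1).factorial * x⁻¹ ^ (k + 1) := by
    rw [inv_pow, div_eq_mul_inv _ (x ^ (k + 1))]
  simp only [hterm]
  obtain ⟨w, hw, hwx⟩ := exists_mul_exp_neg_eq ⟨inv_pos.mpr hx0, hlt⟩
  have hsum : 1 - ∑' k : ℕ, (k : ℝ) ^ k / (k + 1).factorial * x⁻¹ ^ (k + 1) = Real.exp (-w) := by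
    rw [← hwx, tsum_pow_self_div_factorial_succ ⟨by linarith [hw.1], hw.2⟩, sub_sub_cancel]
  rw [hsum, Real.log_exp, ← Real.exp_neg]
  refine ⟨summable_pow_self_div_factorial_succ (by rwa [abs_of_pos (inv_pos.mpr hx0)]),
    ⟨Real.exp_lt_exp.mpr (by linarith [hw.2]), Real.exp_lt_one_iff.mpr (by linarith [hw.1])⟩, ?_⟩
  rw [neg_div, one_div, ← hwx]
  ring
end
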